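/- Let Y = (Y_i)_{i∈ℤ^d} be a random element of ℝ₀^{ℤ^d} satisfying the tail-process identity, such that |Y_0| is Pareto(α)-distributed (α > 0) and independent of the spectral process Θ = Y/|Y_0|. Then for every s ∈ (0,1], every measurable h : ℝ^{ℤ^d} → [0,∞) and every k ∈ ℤ^d: E[h(θ_k Y) 1{|Y_k| > s}] = s^{−α} E[h(s·Y) 1{|Y_{−k}| > 1/s}]. -/

import Mathlib

open MeasureTheory ENNReal Filter ProbabilityTheory

noncomputable section

/-- The space `ℝ^{ℤ^d}` of real-valued fields indexed by `ℤ^d`. -/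
abbrev RField (d : ℕ) := (Fin d → ℤ) → ℝ

variable {d : ℕ}

/-- Shift operator: `shift k x = (x_{i+k})_i`, i.e. it moves the origin to `k`. -/
def shift (k : Fin d → ℤ) (x : RField d) : RField d := fun i => x (i + k)

/-- The set of exceedance-points of `x`. -/
def excSet (x : RField d) : Set (Fin d → ℤ) := {k | 1 < |x k|}

open Classical in
/-- Indicator (with values in `ℝ≥0∞`) of the event that `|x k| > s`. -/
def exIndGT (s : ℝ) (k : Fin d → ℤ) (x : RField d) : ℝ≥0∞ := if s < |x k| then 1 else 0

/-- The tail-process identity: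
`E[h(θ_k Y) 1{|Y_k| > 1}] = E[h(Y) 1{|Y_{−k}| > 1}]` for every measurable nonnegative `h`
and every `k ∈ ℤ^d`. -/
def TailIdentity {Ω : Type*} [MeasurableSpace Ω] (μ : Measure Ω) (Y : Ω → RField d) : Prop :=
  ∀ h : RField d → ℝ≥0∞, Measurable h → ∀ k : Fin d → ℤ,
    ∫⁻ ω, h (shift k (Y ω)) * exIndGT 1 k (Y ω) ∂μ
      = ∫⁻ ω, h (Y ω) * exIndGT 1 (-k) (Y ω) ∂μ

/-- `Y` is exceedance-stationary: for every exceedance-map `τ` which is bijective on a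
measurable set `B` (invariant under shifting the origin to exceedance-points, contained in
`ℝ₀^{ℤ^d}`) carrying the law of `Y`, we have `θ_τ Y ≐ Y`. -/
def ExcStationary {Ω : Type*} [MeasurableSpace Ω] (μ : Measure Ω) (Y : Ω → RField d) : Prop :=
  ∀ (B : Set (RField d)) (τ : RField d → Fin d → ℤ),
    MeasurableSet B → Measurable τ →
    (∀ x ∈ B, 1 < |x 0|) →
    (∀ x ∈ B, ∀ k ∈ excSet x, shift k x ∈ B) →
    (∀ x ∈ B, τ x ∈ excSet x) →
    (∀ x ∈ B, Set.BijOn (fun k => k + τ (shift k x)) (excSet x) (excSet x)) →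
    (∀ᵐ ω ∂μ, Y ω ∈ B) →
    Measure.map (fun ω => shift (τ (Y ω)) (Y ω)) μ = Measure.map Y μ

/-- `E₀`: elements of `ℝ₀^{ℤ^d}` with finitely many exceedance-points. -/
def E0set (d : ℕ) : Set (RField d) := {x | 1 < |x 0| ∧ (excSet x).Finite}

/-- `E`: elements of `ℝ^{ℤ^d}` with at least one but finitely many exceedance-points. -/
def Eset (d : ℕ) : Set (RField d) := {x | (excSet x).Nonempty ∧ (excSet x).Finite}

/-- `l₀`: fields vanishing at infinity. -/
def l0set (d : ℕ) : Set (RField d) := {x | Tendsto (fun i => |x i|) cofinite (nhds 0)}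

/-- Uniform norm `‖x‖ = sup_i |x_i|`. -/
def supNorm (x : RField d) : ℝ := ⨆ i, |x i|

/-- `V` is Pareto(α)-distributed: `P(V > y) = y^{-α}` for `y ≥ 1`. -/
def IsPareto {Ω : Type*} [MeasurableSpace Ω] (μ : Measure Ω) (V : Ω → ℝ) (α : ℝ) : Prop :=
  ∀ y : ℝ, 1 ≤ y → μ {ω | y < V ω} = ENNReal.ofReal (y ^ (-α))

/-- An anchoring function on `S`: a measurable shift-covariant exceedance-map. -/
def IsAnchoringOn (S : Set (RField d)) (A : RField d → Fin d → ℤ) : Prop :=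
  Measurable A ∧ ∀ x ∈ S, A x ∈ excSet x ∧ ∀ k ∈ excSet x, A (shift k x) + k = A x

/-- `h` is shift-invariant on `S`. -/
def ShiftInvariantOn (S : Set (RField d)) (h : RField d → ℝ≥0∞) : Prop :=
  ∀ x ∈ S, ∀ k : Fin d → ℤ, h (shift k x) = h x

theorem measurable_shift (k : Fin d → ℤ) : Measurable (shift k : RField d → RField d) :=
  measurable_pi_lambda _ fun i => measurable_pi_apply (i + k)

theorem measurable_exIndGT (s : ℝ) (k : Fin d → ℤ) :
    Measurable (exIndGT s k : RField d → ℝ≥0∞) :=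
  Measurable.ite (measurableSet_lt measurable_const (measurable_pi_apply k).abs)
    measurable_const measurable_const

/-- Conditionally on exceeding `t ≥ 1`, a Pareto variable is distributed as `t` times itself. -/
theorem restrict_Ioi_eq_smul_map_mul {ν : Measure ℝ} [IsProbabilityMeasure ν] {α : ℝ}
    (hν : ∀ y : ℝ, 1 ≤ y → ν (Set.Ioi y) = ENNReal.ofReal (y ^ (-α))) {t : ℝ} (ht : 1 ≤ t) :
    ν.restrict (Set.Ioi t) = ENNReal.ofReal (t ^ (-α)) • ν.map (fun v => t * v) := by
  have ht0 : 0 < t := zero_lt_one.trans_le ht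
  have hmul : Measurable fun v : ℝ => t * v := measurable_const_mul t
  refine ext_of_generate_finite _ (borel_eq_generateFrom_Ioi ℝ ▸ BorelSpace.measurable_eq)
    isPiSystem_Ioi ?_ ?_
  · rintro _ ⟨a, rfl⟩
    have hpre : (fun v : ℝ => t * v) ⁻¹' Set.Ioi a = Set.Ioi (a / t) := by
      ext v
      simp [div_lt_iff₀' ht0]
    rw [Measure.restrict_apply measurableSet_Ioi, Set.Ioi_inter_Ioi, Measure.smul_apply,
      Measure.map_apply hmul measurableSet_Ioi, hpre, smul_eq_mul]
    rcases le_total t a with hta | hta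
    · rw [sup_eq_left.2 hta, hν a (ht.trans hta), hν (a / t) ((one_le_div ht0).2 hta),
        ← ENNReal.ofReal_mul (by positivity),
        ← Real.mul_rpow ht0.le (div_nonneg (ht0.le.trans hta) ht0.le),
        mul_div_cancel₀ a ht0.ne']
    · have hone : ν (Set.Ioi (a / t)) = 1 := by
        refine le_antisymm prob_le_one ?_
        calc (1 : ℝ≥0∞) = ν (Set.Ioi 1) := by simp [hν 1 le_rfl]
          _ ≤ ν (Set.Ioi (a / t)) :=
            measure_mono (Set.Ioi_subset_Ioi ((div_le_one ht0).2 hta))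
      rw [sup_eq_right.2 hta, hν t ht, hone, mul_one]
  · simp [hν t ht, Measure.map_apply hmul MeasurableSet.univ]

/-- The scaling property of a field whose modulus at the origin is Pareto and independent of the
spectral process: `E[g(Y) 1{|Y_0| > t}] = t^{-α} E[g(tY)]` for `t ≥ 1`. -/
theorem lintegral_mul_exIndGT_zero_eq {Ω : Type*} [MeasurableSpace Ω] {μ : Measure Ω}
    [IsProbabilityMeasure μ] {Y : Ω → RField d} (hY : Measurable Y)
    (hY0 : ∀ᵐ ω ∂μ, 1 < |Y ω 0|) {α : ℝ} (hPar : IsPareto μ (fun ω => |Y ω 0|) α)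
    (hind : IndepFun (fun ω => |Y ω 0|) (fun ω => fun i => Y ω i / |Y ω 0|) μ)
    {t : ℝ} (ht : 1 ≤ t) {g : RField d → ℝ≥0∞} (hg : Measurable g) :
    ∫⁻ ω, g (Y ω) * exIndGT t 0 (Y ω) ∂μ
      = ENNReal.ofReal (t ^ (-α)) * ∫⁻ ω, g (t • Y ω) ∂μ := by
  set V : Ω → ℝ := fun ω => |Y ω 0|
  set Θ : Ω → RField d := fun ω i => Y ω i / |Y ω 0|
  have hV : Measurable V := ((measurable_pi_apply 0).comp hY).abs
  have hΘ : Measurable Θ :=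
    measurable_pi_lambda _ fun i => ((measurable_pi_apply i).comp hY).div hV
  have : IsProbabilityMeasure (μ.map V) := Measure.isProbabilityMeasure_map hV.aemeasurable
  have : IsProbabilityMeasure (μ.map Θ) := Measure.isProbabilityMeasure_map hΘ.aemeasurable
  have hprod : μ.map (fun ω => (V ω, Θ ω)) = (μ.map V).prod (μ.map Θ) :=
    hind.map_prod_eq_prod_map_map hV.aemeasurable hΘ.aemeasurable
  have hpolar : ∀ᵐ ω ∂μ, V ω • Θ ω = Y ω := by
    filter_upwards [hY0] with ω hω
    ext i
    simp only [V, Θ, Pi.smul_apply, smul_eq_mul]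
    exact mul_div_cancel₀ _ (zero_lt_one.trans hω).ne'
  have hlaw : ∀ y : ℝ, 1 ≤ y → μ.map V (Set.Ioi y) = ENNReal.ofReal (y ^ (-α)) := fun y hy => by
    rw [Measure.map_apply hV measurableSet_Ioi]
    exact hPar y hy
  have key {f : ℝ → RField d → ℝ≥0∞} (hf : Measurable (Function.uncurry f)) :
      ∫⁻ ω, f (V ω) (Θ ω) ∂μ = ∫⁻ θ, ∫⁻ v, f v θ ∂μ.map V ∂μ.map Θ := by
    have := lintegral_map (μ := μ) hf (hV.prodMk hΘ)
    rw [hprod, lintegral_prod_symm' _ hf] at this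
    exact this.symm
  have hleft : ∫⁻ ω, g (Y ω) * exIndGT t 0 (Y ω) ∂μ
      = ∫⁻ ω, (Set.Ioi t).indicator (fun v => g (v • Θ ω)) (V ω) ∂μ := by
    refine lintegral_congr_ae ?_
    filter_upwards [hpolar] with ω hω
    simp [Set.indicator_apply, exIndGT, hω, V]
  have hright : ∫⁻ ω, g (t • Y ω) ∂μ = ∫⁻ ω, g ((t * V ω) • Θ ω) ∂μ := by
    refine lintegral_congr_ae ?_
    filter_upwards [hpolar] with ω hω
    rw [mul_smul, hω]
  have hsmul : Measurable fun p : ℝ × RField d => g (p.1 • p.2) :=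
    hg.comp (measurable_fst.smul measurable_snd)
  rw [hleft, hright,
    key (f := fun v θ => (Set.Ioi t).indicator (fun v => g (v • θ)) v)
      (hsmul.indicator (measurable_fst measurableSet_Ioi)),
    key (f := fun v θ => g ((t * v) • θ))
      (hsmul.comp ((measurable_fst.const_mul t).prodMk measurable_snd)),
    ← lintegral_const_mul' _ _ ENNReal.ofReal_ne_top]
  refine lintegral_congr fun θ => ?_
  have hθ : Measurable fun v : ℝ => g (v • θ) := hsmul.comp measurable_prodMk_right
  rw [lintegral_indicator measurableSet_Ioi, restrict_Ioi_eq_smul_map_mul hlaw ht,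
    lintegral_smul_measure, lintegral_map hθ (measurable_const_mul t), smul_eq_mul]

/-- If `Y` satisfies the tail-process identity, `|Y_0|` is Pareto(α)
and independent of the spectral process `Θ = Y/|Y_0|`, then for every `s ∈ (0,1]`,
measurable `h ≥ 0` and `k ∈ ℤ^d`:
`E[h(θ_k Y) 1{|Y_k| > s}] = s^{−α} E[h(s·Y) 1{|Y_{−k}| > 1/s}]`. -/
theorem tail_identity_scaled
    {Ω : Type*} [MeasurableSpace Ω] (μ : Measure Ω) [IsProbabilityMeasure μ]
    (Y : Ω → RField d) (hY : Measurable Y) (hY0 : ∀ᵐ ω ∂μ, 1 < |Y ω 0|)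
    (hTI : TailIdentity μ Y)
    (α : ℝ) (hα : 0 < α) (hPar : IsPareto μ (fun ω => |Y ω 0|) α)
    (hind : IndepFun (fun ω => |Y ω 0|) (fun ω => fun i => Y ω i / |Y ω 0|) μ) :
    ∀ s : ℝ, 0 < s → s ≤ 1 → ∀ h : RField d → ℝ≥0∞, Measurable h → ∀ k : Fin d → ℤ,
      ∫⁻ ω, h (shift k (Y ω)) * exIndGT s k (Y ω) ∂μ
        = ENNReal.ofReal (s ^ (-α)) * ∫⁻ ω, h (s • Y ω) * exIndGT (1 / s) (-k) (Y ω) ∂μ := by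
  intro s hs hs1 h hh k
  have ht : 1 ≤ 1 / s := (one_le_div hs).2 hs1
  have hsY : Measurable fun x : RField d => h (s • x) := hh.comp (measurable_const_smul s)
  have hscale := lintegral_mul_exIndGT_zero_eq hY hY0 hPar hind ht
    (g := fun x => h (s • shift k x) * exIndGT 1 k x)
    ((hsY.comp (measurable_shift k)).mul (measurable_exIndGT 1 k))
  have hshift := hTI (fun x => h (s • x) * exIndGT (1 / s) (-k) x)
    (hsY.mul (measurable_exIndGT (1 / s) (-k))) k
  have hleft (x : RField d) : h (s • shift k ((1 / s) • x)) * exIndGT 1 k ((1 / s) • x)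
      = h (shift k x) * exIndGT s k x := by
    have hx : s • shift k ((1 / s) • x) = shift k x := by
      ext i
      simp [shift, hs.ne']
    have hk : 1 < |((1 / s) • x) k| ↔ s < |x k| := by
      rw [Pi.smul_apply, smul_eq_mul, abs_mul, abs_of_pos (one_div_pos.2 hs), one_div,
        ← div_eq_inv_mul, one_lt_div hs]
    simp only [exIndGT, hx, hk]
  have hmid (x : RField d) :
      h (s • shift k x) * exIndGT (1 / s) (-k) (shift k x) * exIndGT 1 k x
        = h (s • shift k x) * exIndGT 1 k x * exIndGT (1 / s) 0 x := by
    simp only [exIndGT, shift, neg_add_cancel]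
    exact mul_right_comm _ _ _
  have hright (x : RField d) : h (s • x) * exIndGT (1 / s) (-k) x * exIndGT 1 (-k) x
      = h (s • x) * exIndGT (1 / s) (-k) x := by
    by_cases hx : 1 / s < |x (-k)|
    · simp [exIndGT, ht.trans_lt hx]
    · simp only [exIndGT, if_neg hx, mul_zero, zero_mul]
  simp only [hleft] at hscale
  simp only [hmid, hright] at hshift
  rw [← hshift, hscale, ← mul_assoc, ← ENNReal.ofReal_mul (by positivity),
    ← Real.mul_rpow hs.le (one_div_pos.2 hs).le, mul_one_div_cancel hs.ne', Real.one_rpow,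
    ENNReal.ofReal_one, one_mul]
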